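/- arXiv:2409.03505 — 2 statements merged into one kernel-verified Lean document; each statement's English description precedes it below -/
import Mathlib

section
/- Fix q ∈ (0,1), β ∈ [0,∞), γ ∈ (0,∞), ζ ∈ (0, (min{q,1−q})^{1/(β+1)}/γ), and τ ∈ [0, min{q,1−q} − (γζ)^{β+1}]. For every (possibly randomized) data-driven algorithm that maps n IID demand samples to a decision A ≥ 0, there exists a (β,γ,ζ)-clustered probability distribution on [0,∞) with CDF F, optimal decision a*, and expected loss L, satisfying F(a*−ζ) ≥ τ and F(a*+ζ) ≤ 1−τ, such that with probability at least 1/3, the multiplicative regret satisfies (L(A) − L(a*))/L(a*) ≥ (1/(16γζτ + 8q(1−q)))·((q−τ)(1−q−τ)/(3√n))^{(β+2)/(β+1)}. -/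
open MeasureTheory Set

noncomputable section

/-- The Newsvendor loss `ℓ(a,Z) = q·max{Z−a,0} + (1−q)·max{a−Z,0}` with critical quantile `q`. -/
def nvLoss (q a z : ℝ) : ℝ := q * max (z - a) 0 + (1 - q) * max (a - z) 0

/-- The expected Newsvendor loss `L(a)` under the demand distribution `μ`. -/
def expLoss (q : ℝ) (μ : Measure ℝ) (a : ℝ) : ℝ := ∫ z, nvLoss q a z ∂μ

/-- The CDF of the demand distribution `μ`. -/
def cdf' (μ : Measure ℝ) (z : ℝ) : ℝ := (μ (Iic z)).toReal

/-- The optimal decision `a* = inf {a ≥ 0 : F(a) ≥ q}`. -/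
def optDec (q : ℝ) (μ : Measure ℝ) : ℝ := sInf {a : ℝ | 0 ≤ a ∧ q ≤ cdf' μ a}

/-- The empirical CDF of the samples `ω : Fin n → ℝ`. -/
def empCdf (n : ℕ) (ω : Fin n → ℝ) (z : ℝ) : ℝ :=
  (∑ i : Fin n, if ω i ≤ z then (1 : ℝ) else 0) / n

/-- The SAA (sample average approximation) decision `â = inf {a ≥ 0 : F̂(a) ≥ q}`. -/
def saa (q : ℝ) (n : ℕ) (ω : Fin n → ℝ) : ℝ := sInf {a : ℝ | 0 ≤ a ∧ q ≤ empCdf n ω a}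

/-- The joint law of `n` iid samples from `μ`. -/
def iid (μ : Measure ℝ) (n : ℕ) : Measure (Fin n → ℝ) := Measure.pi fun _ => μ

/-- A distribution `μ` is `(β,γ,ζ)`-clustered if
`|a − a*| ≤ (1/γ)·|F(a) − q|^{1/(β+1)}` for all `a ∈ [a*−ζ, a*+ζ]`. -/
def Clustered (q β γ ζ : ℝ) (μ : Measure ℝ) : Prop :=
  ∀ a ∈ Icc (optDec q μ - ζ) (optDec q μ + ζ),
    |a - optDec q μ| ≤ (1 / γ) * |cdf' μ a - q| ^ ((1 : ℝ) / (β + 1))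

/-- The law on `ℝ` putting mass `p i` at the point `x i`. -/
def atomicLaw {ι : Type*} [Fintype ι] [MeasurableSpace ι] (p x : ι → ℝ) : Measure ℝ :=
  (∑ i, ENNReal.ofReal (p i) • Measure.dirac i : Measure ι).map x

section AtomicLaw

variable {ι : Type*} [Fintype ι] [MeasurableSpace ι] {p x : ι → ℝ}

theorem isProbabilityMeasure_sum_smul_dirac (hp : ∀ i, 0 ≤ p i) (hp1 : ∑ i, p i = 1) :
    IsProbabilityMeasure (∑ i, ENNReal.ofReal (p i) • Measure.dirac i : Measure ι) := by
  constructor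
  simp [Measure.finsetSum_apply, ← ENNReal.ofReal_sum_of_nonneg (fun i _ => hp i), hp1]

variable [MeasurableSingletonClass ι]

theorem sum_smul_dirac_singleton (i : ι) :
    (∑ j, ENNReal.ofReal (p j) • Measure.dirac j : Measure ι) {i} = ENNReal.ofReal (p i) := by
  classical
  simp [Measure.finsetSum_apply, Set.indicator_apply]

theorem isProbabilityMeasure_atomicLaw (hp : ∀ i, 0 ≤ p i) (hp1 : ∑ i, p i = 1) :
    IsProbabilityMeasure (atomicLaw p x) := by
  have := isProbabilityMeasure_sum_smul_dirac hp hp1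
  exact Measure.isProbabilityMeasure_map (measurable_of_finite x).aemeasurable

theorem atomicLaw_apply {s : Set ℝ} [DecidablePred (· ∈ s)] (hs : MeasurableSet s) :
    atomicLaw p x s = ∑ i, if x i ∈ s then ENNReal.ofReal (p i) else 0 := by
  classical
  rw [atomicLaw, Measure.map_apply (measurable_of_finite x) hs]
  simp only [Measure.finsetSum_apply, Measure.smul_apply, Measure.dirac_apply, smul_eq_mul,
    Set.indicator_apply, mem_preimage, Pi.one_apply, mul_ite, mul_one, mul_zero]

theorem cdf'_atomicLaw (hp : ∀ i, 0 ≤ p i) (z : ℝ) :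
    cdf' (atomicLaw p x) z = ∑ i, if x i ≤ z then p i else 0 := by
  classical
  rw [cdf', atomicLaw_apply measurableSet_Iic, ENNReal.toReal_sum]
  · refine Finset.sum_congr rfl fun i _ => ?_
    by_cases h : x i ≤ z <;> simp [h, hp i]
  · intro i _
    split_ifs <;> simp

theorem integral_atomicLaw (hp : ∀ i, 0 ≤ p i) {f : ℝ → ℝ} (hf : Measurable f) :
    ∫ z, f z ∂(atomicLaw p x) = ∑ i, p i * f (x i) := by
  have : IsFiniteMeasure (∑ i, ENNReal.ofReal (p i) • Measure.dirac i : Measure ι) := by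
    constructor
    simp [Measure.finsetSum_apply]
  rw [atomicLaw, integral_map (measurable_of_finite x).aemeasurable hf.aestronglyMeasurable,
    integral_fintype Integrable.of_finite]
  simp [measureReal_def, sum_smul_dirac_singleton, hp]

theorem integrable_atomicLaw {f : ℝ → ℝ} (hf : Measurable f) :
    Integrable f (atomicLaw p x) := by
  have : IsFiniteMeasure (∑ i, ENNReal.ofReal (p i) • Measure.dirac i : Measure ι) := by
    constructor
    simp [Measure.finsetSum_apply]
  rw [atomicLaw, integrable_map_measure hf.aestronglyMeasurable
    (measurable_of_finite x).aemeasurable]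
  exact Integrable.of_finite

theorem expLoss_atomicLaw (hp : ∀ i, 0 ≤ p i) (q a : ℝ) :
    expLoss q (atomicLaw p x) a = ∑ i, p i * nvLoss q a (x i) :=
  integral_atomicLaw hp (by unfold nvLoss; fun_prop)

theorem iid_atomicLaw_prod_apply (hp : ∀ i, 0 ≤ p i) (hp1 : ∑ i, p i = 1) (n : ℕ)
    {Ω : Type*} [MeasurableSpace Ω] (ν : Measure Ω) [IsProbabilityMeasure ν]
    {E : Set ((Fin n → ℝ) × Ω)} (hE : MeasurableSet E) :
    ((iid (atomicLaw p x) n).prod ν) E =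
      ENNReal.ofReal (∑ s : Fin n → ι, (∏ i, p (s i)) *
        ν.real (Prod.mk (fun i => x (s i)) ⁻¹' E)) := by
  have := isProbabilityMeasure_sum_smul_dirac hp hp1
  have := isProbabilityMeasure_atomicLaw (x := x) hp hp1
  have hmap : iid (atomicLaw p x) n =
      (Measure.pi fun _ : Fin n =>
        (∑ i, ENNReal.ofReal (p i) • Measure.dirac i : Measure ι)).map
        fun s i => x (s i) :=
    (Measure.pi_map_pi fun _ => (measurable_of_finite x).aemeasurable).symm
  have hm : Measurable fun (s : Fin n → ι) i => x (s i) := measurable_of_finite _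
  have : IsProbabilityMeasure (iid (atomicLaw p x) n) := by unfold iid; infer_instance
  rw [Measure.prod_apply hE, hmap, lintegral_map (measurable_measure_prodMk_left hE) hm,
    lintegral_fintype, ENNReal.ofReal_sum_of_nonneg]
  · refine Finset.sum_congr rfl fun s _ => ?_
    rw [Measure.pi_singleton, ENNReal.ofReal_mul (Finset.prod_nonneg fun i _ => hp _),
      ENNReal.ofReal_prod_of_nonneg fun i _ => hp _, mul_comm]
    simp [sum_smul_dirac_singleton]
  · exact fun s _ => mul_nonneg (Finset.prod_nonneg fun i _ => hp _) measureReal_nonneg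

end AtomicLaw

/-- A two-point testing bound through the chi-square divergence. -/
theorem sum_mul_sub_le_chiSq {κ : Type*} [Fintype κ] {u w g : κ → ℝ}
    (hw : ∀ s, 0 ≤ w s) (huw : ∀ s, w s = 0 → u s = 0)
    (hu1 : ∑ s, u s = 1) (hw1 : ∑ s, w s = 1) (hg0 : ∀ s, 0 ≤ g s) (hg1 : ∀ s, g s ≤ 1) :
    ∑ s, w s * g s - ∑ s, u s * g s ≤ (∑ s, u s ^ 2 / w s - 1) / 2 + 1 / 8 := by
  have key : ∀ s, w s * g s - u s * g s ≤
      u s ^ 2 / w s / 2 + (1 / 8) * w s + w s - (3 / 2) * u s := by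
    intro s
    rcases (hw s).eq_or_lt with h | h
    · simp [← h, huw s h.symm]
    · have e : u s = w s * (u s / w s) := by field_simp
      have e2 : u s ^ 2 / w s = w s * (u s / w s) ^ 2 := by field_simp
      rw [e2]
      set r := u s / w s
      rw [e]
      have hg2 : (g s - 1 / 2) ^ 2 ≤ 1 / 4 := by nlinarith [hg0 s, hg1 s]
      have : g s - r * g s ≤ r ^ 2 / 2 + 1 / 8 + 1 - 3 / 2 * r := by
        nlinarith [sq_nonneg ((r - 1) + (g s - 1 / 2))]
      nlinarith [mul_le_mul_of_nonneg_left this h.le]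
  have := Finset.sum_le_sum fun s (_ : s ∈ Finset.univ) => key s
  simp only [Finset.sum_sub_distrib, Finset.sum_add_distrib, ← Finset.sum_div,
    ← Finset.mul_sum, hu1, hw1] at this
  linarith

theorem sum_prod_eq_pow {ι : Type*} [Fintype ι] (f : ι → ℝ) (n : ℕ) :
    ∑ s : Fin n → ι, ∏ i, f (s i) = (∑ i, f i) ^ n := by
  classical
  have := Finset.prod_univ_sum (fun _ : Fin n => (Finset.univ : Finset ι)) fun _ j => f j
  simpa using this.symm

/-- Two `n`-fold product laws with per-sample chi-square divergence at most `1/(6n)` give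
test functions expectations within `1/3` of each other. -/
theorem sum_prod_mul_sub_le {ι : Type*} [Fintype ι] {p r : ι → ℝ} {n : ℕ} (hn : 1 ≤ n)
    (hr : ∀ i, 0 ≤ r i) (hpr : ∀ i, r i = 0 → p i = 0)
    (hp1 : ∑ i, p i = 1) (hr1 : ∑ i, r i = 1)
    (hchi : ∑ i, p i ^ 2 / r i ≤ 1 + 1 / (6 * n))
    {g : (Fin n → ι) → ℝ} (hg0 : ∀ s, 0 ≤ g s) (hg1 : ∀ s, g s ≤ 1) :
    ∑ s, (∏ i, r (s i)) * g s - ∑ s, (∏ i, p (s i)) * g s ≤ 1 / 3 := by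
  have h := sum_mul_sub_le_chiSq (u := fun s : Fin n → ι => ∏ i, p (s i))
    (w := fun s : Fin n → ι => ∏ i, r (s i)) (g := g)
    (fun s => Finset.prod_nonneg fun i _ => hr _)
    (fun s h0 => by
      obtain ⟨i, hi, h0⟩ := Finset.prod_eq_zero_iff.1 h0
      exact Finset.prod_eq_zero hi (hpr _ h0))
    (by rw [sum_prod_eq_pow, hp1, one_pow]) (by rw [sum_prod_eq_pow, hr1, one_pow]) hg0 hg1
  have hpow : ∑ s : Fin n → ι, (∏ i, p (s i)) ^ 2 / ∏ i, r (s i) =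
      (∑ i, p i ^ 2 / r i) ^ n := by
    rw [← sum_prod_eq_pow]
    simp [Finset.prod_div_distrib, Finset.prod_pow]
  have hn0 : (0 : ℝ) < n := by exact_mod_cast hn
  have hbound : (∑ i, p i ^ 2 / r i) ^ n ≤ 6 / 5 := by
    calc (∑ i, p i ^ 2 / r i) ^ n ≤ (Real.exp (1 / (6 * n))) ^ n := by
          refine pow_le_pow_left₀ (Finset.sum_nonneg fun i _ => div_nonneg (sq_nonneg _) (hr i))
            (hchi.trans ?_) n
          linarith [Real.add_one_le_exp (1 / (6 * (n : ℝ)))]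
      _ = Real.exp (1 / 6) := by
          rw [← Real.exp_nat_mul]; congr 1; field_simp
      _ ≤ 6 / 5 := by
          have h1 := Real.add_one_le_exp (-(1 / 6 : ℝ))
          rw [Real.exp_neg] at h1
          have h2 := Real.exp_pos (1 / 6 : ℝ)
          have h3 : Real.exp (1 / 6) * (Real.exp (1 / 6))⁻¹ = 1 := mul_inv_cancel₀ h2.ne'
          nlinarith
  rw [hpow] at h
  linarith

theorem nvLoss_sub_ge_of_le {q a A z : ℝ} (hq0 : 0 ≤ q) (hq1 : q ≤ 1) (haA : a ≤ A) :
    (A - a) * ((if z ≤ a then 1 else 0) - q) ≤ nvLoss q A z - nvLoss q a z := by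
  unfold nvLoss
  split_ifs with h
  · rw [max_eq_right (by linarith : z - A ≤ 0), max_eq_right (by linarith : z - a ≤ 0),
      max_eq_left (by linarith : 0 ≤ A - z), max_eq_left (by linarith : 0 ≤ a - z)]
    linarith
  · rw [max_eq_left (by linarith : 0 ≤ z - a), max_eq_right (by linarith : a - z ≤ 0)]
    nlinarith [le_max_left (z - A) 0, le_max_right (A - z) 0,
      mul_le_mul_of_nonneg_left (le_max_left (z - A) 0) hq0,
      mul_nonneg (sub_nonneg.2 hq1) (le_max_right (A - z) 0)]

theorem nvLoss_sub_ge_of_ge {q a A z : ℝ} (hq0 : 0 ≤ q) (hq1 : q ≤ 1) (hAa : A ≤ a) :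
    (a - A) * (q - if z < a then 1 else 0) ≤ nvLoss q A z - nvLoss q a z := by
  unfold nvLoss
  split_ifs with h
  · rw [max_eq_right (by linarith : z - a ≤ 0), max_eq_left (by linarith : 0 ≤ a - z)]
    nlinarith [mul_nonneg hq0 (le_max_right (z - A) 0),
      mul_le_mul_of_nonneg_left (le_max_left (A - z) 0) (sub_nonneg.2 hq1)]
  · rw [max_eq_left (by linarith : 0 ≤ z - A), max_eq_left (by linarith : 0 ≤ z - a),
      max_eq_right (by linarith : A - z ≤ 0), max_eq_right (by linarith : a - z ≤ 0)]
    linarith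

theorem le_one_div_mul_rpow {γ β t y : ℝ} (hγ : 0 < γ) (hβ : 0 ≤ β) (ht : 0 ≤ t)
    (h : (γ * t) ^ (β + 1) ≤ y) : t ≤ 1 / γ * y ^ (1 / (β + 1)) := by
  have hb : 0 < β + 1 := by linarith
  have h1 : γ * t ≤ y ^ (1 / (β + 1)) := by
    have := Real.rpow_le_rpow (by positivity) h (by positivity : 0 ≤ 1 / (β + 1))
    rwa [← Real.rpow_mul (by positivity), mul_one_div_cancel hb.ne', Real.rpow_one] at this
  rw [one_div, inv_mul_eq_div, le_div_iff₀ hγ]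
  linarith

/-- If the CDF stays below `q` before `a` and reaches `q` at `a`, then `a` is the optimal
decision. -/
theorem optDec_eq {q a : ℝ} {μ : Measure ℝ} (ha : 0 ≤ a) (hle : q ≤ cdf' μ a)
    (hlt : ∀ z, z < a → cdf' μ z < q) : optDec q μ = a := by
  refine IsLeast.csInf_eq ⟨⟨ha, hle⟩, fun z hz => ?_⟩
  by_contra h
  exact absurd hz.2 (not_le.2 (hlt z (not_le.1 h)))

/-- The support of the two hard instances: two tails around the two candidate optima
`ζ` and `ζ + H`. -/
def hardNodes (ζ H : ℝ) : Fin 4 → ℝ := ![0, ζ, ζ + H, 3 * ζ + H]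

/-- The masses of a hard instance; the sign of `e` decides which candidate is optimal. -/
def hardWeights (q τ e : ℝ) : Fin 4 → ℝ := ![τ, q - τ + e, 1 - q - τ - e, τ]

section HardInstance

variable {q τ e ζ H : ℝ}

theorem hardWeights_nonneg (hτ : 0 ≤ τ) (h1 : 0 ≤ q - τ + e) (h2 : 0 ≤ 1 - q - τ - e)
    (i : Fin 4) : 0 ≤ hardWeights q τ e i := by
  fin_cases i
  exacts [hτ, h1, h2, hτ]

theorem sum_hardWeights : ∑ i, hardWeights q τ e i = 1 := by
  simp [Fin.sum_univ_four, hardWeights]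
  ring

theorem cdf'_hard (hp : ∀ i, 0 ≤ hardWeights q τ e i) (z : ℝ) :
    cdf' (atomicLaw (hardWeights q τ e) (hardNodes ζ H)) z =
      (if 0 ≤ z then τ else 0) + (if ζ ≤ z then q - τ + e else 0) +
      (if ζ + H ≤ z then 1 - q - τ - e else 0) + (if 3 * ζ + H ≤ z then τ else 0) := by
  rw [cdf'_atomicLaw hp, Fin.sum_univ_four]
  rfl

theorem expLoss_hard (hp : ∀ i, 0 ≤ hardWeights q τ e i) (a : ℝ) :
    expLoss q (atomicLaw (hardWeights q τ e) (hardNodes ζ H)) a =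
      τ * nvLoss q a 0 + (q - τ + e) * nvLoss q a ζ + (1 - q - τ - e) * nvLoss q a (ζ + H) +
        τ * nvLoss q a (3 * ζ + H) := by
  rw [expLoss_atomicLaw hp]
  simp [Fin.sum_univ_four, hardWeights, hardNodes]

theorem atomicLaw_hard_Iio_zero (hζ : 0 < ζ) (hH : 0 < H) :
    atomicLaw (hardWeights q τ e) (hardNodes ζ H) (Iio 0) = 0 := by
  classical
  rw [atomicLaw_apply measurableSet_Iio]
  have h2 : ¬ ζ + H < 0 := by linarith
  have h3 : ¬ 3 * ζ + H < 0 := by linarith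
  simp [Fin.sum_univ_four, hardNodes, hζ.not_gt, h2, h3]

/-- Per-sample chi-square divergence of the two hard instances. -/
theorem chiSq_hardWeights_le {n : ℕ} (hn : 1 ≤ n) (hτ : 0 ≤ τ) (hx : 0 < q - τ)
    (hy : 0 < 1 - q - τ) (he : 0 < e)
    (hsq : e ^ 2 = ((q - τ) * (1 - q - τ)) ^ 2 / (9 * n))
    (hle : e ≤ (q - τ) / 3) :
    ∑ i, hardWeights q τ e i ^ 2 / hardWeights q τ (-e) i ≤ 1 + 1 / (6 * n) := by
  have hn0 : (0 : ℝ) < n := by exact_mod_cast hn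
  obtain ⟨x, hxd⟩ : ∃ x, x = q - τ := ⟨_, rfl⟩
  obtain ⟨y, hyd⟩ : ∃ y, y = 1 - q - τ := ⟨_, rfl⟩
  have hxy : x + y + 2 * τ = 1 := by rw [hxd, hyd]; ring
  simp only [Fin.sum_univ_four, hardWeights, Matrix.cons_val, ← hxd, ← hyd] at *
  have e0 : τ ^ 2 / τ = τ := by
    rcases hτ.eq_or_lt with h | h
    · simp [← h]
    · field_simp
  have hxe : 0 < x - e := by linarith
  have hye : 0 < y + e := by linarith
  have e1 : (x + e) ^ 2 / (x + -e) = x + 3 * e + 4 * (e ^ 2 / (x - e)) := by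
    rw [← sub_eq_add_neg]; field_simp; ring
  have e2 : (y - e) ^ 2 / (y - -e) = y - 3 * e + 4 * (e ^ 2 / (y + e)) := by
    rw [sub_neg_eq_add]; field_simp; ring
  have b1 : e ^ 2 / (x - e) ≤ x * y ^ 2 / (6 * n) := by
    calc e ^ 2 / (x - e) ≤ e ^ 2 / (2 / 3 * x) := by
          apply div_le_div_of_nonneg_left (sq_nonneg _) (by positivity); linarith
      _ = x * y ^ 2 / (6 * n) := by rw [hsq]; field_simp; norm_num
  have b2 : e ^ 2 / (y + e) ≤ x ^ 2 * y / (9 * n) := by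
    calc e ^ 2 / (y + e) ≤ e ^ 2 / y := by
          apply div_le_div_of_nonneg_left (sq_nonneg _) hy; linarith
      _ = x ^ 2 * y / (9 * n) := by rw [hsq]; field_simp
  have b3 : 4 * (x * y ^ 2 / (6 * n)) + 4 * (x ^ 2 * y / (9 * n)) ≤ 1 / (6 * n) := by
    have hxy1 : x + y ≤ 1 := by linarith
    have hxy4 : x * y ≤ 1 / 4 := by nlinarith [sq_nonneg (x - y)]
    have : x * y * (24 * y + 16 * x) ≤ 6 := by
      nlinarith [mul_pos hx hy, mul_le_mul_of_nonneg_left hxy1 (mul_pos hx hy).le]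
    have e3 : 4 * (x * y ^ 2 / (6 * n)) + 4 * (x ^ 2 * y / (9 * n)) =
        (x * y * (24 * y + 16 * x) / 6) * (1 / (6 * n)) := by field_simp; ring
    rw [e3]
    exact mul_le_of_le_one_left (by positivity) (by linarith)
  rw [e0, e1, e2]
  linarith

end HardInstance

/-- The instance whose optimal decision is the smaller candidate `ζ`. -/
theorem hard_pos_spec {q β γ ζ τ e H : ℝ} (hq0 : 0 < q) (hq1 : q < 1) (hβ : 0 ≤ β) (hγ : 0 < γ)
    (hζ : 0 < ζ) (hτ : 0 ≤ τ) (hH : 0 < H) (he : 0 < e) (heH : (γ * H) ^ (β + 1) = e)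
    (hx : (γ * ζ) ^ (β + 1) ≤ q - τ) (hy : (γ * ζ) ^ (β + 1) ≤ 1 - q - τ) (hey : e < 1 - q - τ) :
    ∃ μ, μ = atomicLaw (hardWeights q τ e) (hardNodes ζ H) ∧
      optDec q μ = ζ ∧ Clustered q β γ ζ μ ∧
      τ ≤ cdf' μ (ζ - ζ) ∧ cdf' μ (ζ + ζ) ≤ 1 - τ ∧
      0 < expLoss q μ ζ ∧ expLoss q μ ζ ≤ 2 * ζ * τ + q * (1 - q) * H ∧
      ∀ A, ζ + H / 2 ≤ A → e * H / 2 ≤ expLoss q μ A - expLoss q μ ζ := by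
  have hγζ : 0 < (γ * ζ) ^ (β + 1) := by positivity
  have hp := hardWeights_nonneg (e := e) hτ (by linarith : 0 ≤ q - τ + e) (by linarith)
  refine ⟨_, rfl, ?_⟩
  set μ := atomicLaw (hardWeights q τ e) (hardNodes ζ H)
  have hcdf := cdf'_hard (ζ := ζ) (H := H) hp
  have hlow : ∀ z, z < ζ → cdf' μ z ≤ τ := fun z hz => by
    rw [hcdf, if_neg (not_le.2 hz), if_neg (by linarith : ¬ ζ + H ≤ z),
      if_neg (by linarith : ¬ 3 * ζ + H ≤ z)]
    split_ifs <;> linarith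
  have hmid : ∀ z, ζ ≤ z → z < ζ + H → cdf' μ z = q + e := fun z h1 h2 => by
    rw [hcdf, if_pos (by linarith), if_pos h1, if_neg (by linarith), if_neg (by linarith)]
    ring
  have hhigh : ∀ z, ζ + H ≤ z → z < 3 * ζ + H → cdf' μ z = 1 - τ := fun z h1 h2 => by
    rw [hcdf, if_pos (by linarith), if_pos (by linarith), if_pos h1, if_neg (by linarith)]
    ring
  have hopt : optDec q μ = ζ := optDec_eq hζ.le
    (by rw [hmid ζ le_rfl (by linarith)]; linarith)
    fun z hz => by linarith [hlow z hz]
  refine ⟨hopt, ?_, ?_, ?_, ?_, ?_, ?_⟩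
  · intro z hz
    rw [hopt] at hz ⊢
    refine le_one_div_mul_rpow hγ hβ (abs_nonneg _) ?_
    have hmono : ∀ t s : ℝ, 0 ≤ t → t ≤ s → (γ * t) ^ (β + 1) ≤ (γ * s) ^ (β + 1) := by
      intro t s ht hts
      exact Real.rpow_le_rpow (by positivity) (by gcongr) (by linarith)
    have habs : |z - ζ| ≤ ζ := abs_le.2 ⟨by linarith [hz.1], by linarith [hz.2]⟩
    have hζz := hmono _ _ (abs_nonneg _) habs
    rcases lt_or_ge z ζ with h | h
    · rw [abs_of_nonpos (by linarith [hlow z h] : cdf' μ z - q ≤ 0)]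
      linarith [hlow z h]
    · rcases lt_or_ge z (ζ + H) with h' | h'
      · rw [hmid z h h', add_sub_cancel_left, abs_of_pos he, ← heH]
        exact hmono _ _ (abs_nonneg _) (abs_le.2 ⟨by linarith, by linarith⟩)
      · rw [hhigh z h' (by linarith [hz.2]), abs_of_nonneg (by linarith : 0 ≤ 1 - τ - q)]
        linarith
  · rw [hcdf, if_pos (by linarith), if_neg (by linarith), if_neg (by linarith),
      if_neg (by linarith)]
    linarith
  · rcases lt_or_ge (ζ + ζ) (ζ + H) with h | h
    · rw [hmid _ (by linarith) h]; linarith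
    · rw [hhigh _ h (by linarith)]
  · rw [expLoss_hard hp]
    simp only [nvLoss]
    rw [max_eq_right (by linarith : 0 - ζ ≤ 0), max_eq_left (by linarith : 0 ≤ ζ - 0), sub_self,
      max_eq_left (by linarith : 0 ≤ ζ + H - ζ), max_eq_right (by linarith : ζ - (ζ + H) ≤ 0),
      max_eq_left (by linarith : 0 ≤ 3 * ζ + H - ζ),
      max_eq_right (by linarith : ζ - (3 * ζ + H) ≤ 0)]
    have h1 : 0 < (1 - q - τ - e) * (q * H) := mul_pos (by linarith) (by positivity)
    have h2 : 0 ≤ τ * ((1 - q) * ζ) := mul_nonneg hτ (mul_nonneg (by linarith) hζ.le)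
    have h3 : 0 ≤ τ * (q * (2 * ζ + H)) := by positivity
    simp only [max_self]
    linarith
  · rw [expLoss_hard hp]
    simp only [nvLoss]
    rw [max_eq_right (by linarith : 0 - ζ ≤ 0), max_eq_left (by linarith : 0 ≤ ζ - 0), sub_self,
      max_eq_left (by linarith : 0 ≤ ζ + H - ζ), max_eq_right (by linarith : ζ - (ζ + H) ≤ 0),
      max_eq_left (by linarith : 0 ≤ 3 * ζ + H - ζ),
      max_eq_right (by linarith : ζ - (3 * ζ + H) ≤ 0)]
    simp only [max_self]
    have h1 : 0 ≤ e * (q * H) := by positivity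
    have h2 : 0 ≤ (1 - q) * (τ * ζ) := mul_nonneg (by linarith) (by positivity)
    linarith
  · intro A hA
    rw [expLoss_hard hp, expLoss_hard hp]
    have g := fun z => nvLoss_sub_ge_of_le (z := z) hq0.le hq1.le (by linarith : ζ ≤ A)
    have g0 := g 0
    have g1 := g ζ
    have g2 := g (ζ + H)
    have g3 := g (3 * ζ + H)
    rw [if_pos (by linarith)] at g0 g1
    rw [if_neg (by linarith)] at g2 g3
    have m0 := mul_le_mul_of_nonneg_left g0 hτ
    have m1 := mul_le_mul_of_nonneg_left g1 (by linarith : 0 ≤ q - τ + e)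
    have m2 := mul_le_mul_of_nonneg_left g2 (by linarith : 0 ≤ 1 - q - τ - e)
    have m3 := mul_le_mul_of_nonneg_left g3 hτ
    have m := mul_le_mul_of_nonneg_left (by linarith : H / 2 ≤ A - ζ) he.le
    linarith

/-- The instance whose optimal decision is the larger candidate `ζ + H`. -/
theorem hard_neg_spec {q β γ ζ τ e H : ℝ} (hq0 : 0 < q) (hq1 : q < 1) (hβ : 0 ≤ β) (hγ : 0 < γ)
    (hζ : 0 < ζ) (hτ : 0 ≤ τ) (hH : 0 < H) (he : 0 < e) (heH : (γ * H) ^ (β + 1) = e)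
    (hx : (γ * ζ) ^ (β + 1) ≤ q - τ) (hy : (γ * ζ) ^ (β + 1) ≤ 1 - q - τ) (hex : e < q - τ) :
    ∃ μ, μ = atomicLaw (hardWeights q τ (-e)) (hardNodes ζ H) ∧
      optDec q μ = ζ + H ∧ Clustered q β γ ζ μ ∧
      τ ≤ cdf' μ (ζ + H - ζ) ∧ cdf' μ (ζ + H + ζ) ≤ 1 - τ ∧
      0 < expLoss q μ (ζ + H) ∧ expLoss q μ (ζ + H) ≤ 2 * ζ * τ + q * (1 - q) * H ∧
      ∀ A, A ≤ ζ + H / 2 → e * H / 2 ≤ expLoss q μ A - expLoss q μ (ζ + H) := by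
  have hγζ : 0 < (γ * ζ) ^ (β + 1) := by positivity
  have hp := hardWeights_nonneg (e := -e) hτ (by linarith : 0 ≤ q - τ + -e) (by linarith)
  refine ⟨_, rfl, ?_⟩
  set μ := atomicLaw (hardWeights q τ (-e)) (hardNodes ζ H)
  have hcdf := cdf'_hard (ζ := ζ) (H := H) hp
  have hlow : ∀ z, z < ζ → cdf' μ z ≤ τ := fun z hz => by
    rw [hcdf, if_neg (not_le.2 hz), if_neg (by linarith : ¬ ζ + H ≤ z),
      if_neg (by linarith : ¬ 3 * ζ + H ≤ z)]
    split_ifs <;> linarith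
  have hmid : ∀ z, ζ ≤ z → z < ζ + H → cdf' μ z = q - e := fun z h1 h2 => by
    rw [hcdf, if_pos (by linarith), if_pos h1, if_neg (by linarith), if_neg (by linarith)]
    ring
  have hhigh : ∀ z, ζ + H ≤ z → z < 3 * ζ + H → cdf' μ z = 1 - τ := fun z h1 h2 => by
    rw [hcdf, if_pos (by linarith), if_pos (by linarith), if_pos h1, if_neg (by linarith)]
    ring
  have hopt : optDec q μ = ζ + H := by
    refine optDec_eq (by linarith) (by rw [hhigh _ le_rfl (by linarith)]; linarith) fun z hz => ?_
    rcases lt_or_ge z ζ with h | h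
    · linarith [hlow z h]
    · linarith [hmid z h hz]
  refine ⟨hopt, ?_, ?_, ?_, ?_, ?_, ?_⟩
  · intro z hz
    rw [hopt] at hz ⊢
    refine le_one_div_mul_rpow hγ hβ (abs_nonneg _) ?_
    have hmono : ∀ t s : ℝ, 0 ≤ t → t ≤ s → (γ * t) ^ (β + 1) ≤ (γ * s) ^ (β + 1) := by
      intro t s ht hts
      exact Real.rpow_le_rpow (by positivity) (by gcongr) (by linarith)
    have habs : |z - (ζ + H)| ≤ ζ := abs_le.2 ⟨by linarith [hz.1], by linarith [hz.2]⟩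
    have hζz := hmono _ _ (abs_nonneg _) habs
    rcases lt_or_ge z ζ with h | h
    · rw [abs_of_nonpos (by linarith [hlow z h] : cdf' μ z - q ≤ 0)]
      linarith [hlow z h]
    · rcases lt_or_ge z (ζ + H) with h' | h'
      · rw [hmid z h h', sub_sub_cancel_left, abs_neg, abs_of_pos he, ← heH]
        exact hmono _ _ (abs_nonneg _) (abs_le.2 ⟨by linarith, by linarith⟩)
      · rw [hhigh z h' (by linarith [hz.2]), abs_of_nonneg (by linarith : 0 ≤ 1 - τ - q)]
        linarith
  · rcases lt_or_ge (ζ + H - ζ) ζ with h | h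
    · rw [hcdf, if_pos (by linarith), if_neg (by linarith), if_neg (by linarith),
        if_neg (by linarith)]
      linarith
    · rw [hmid _ h (by linarith)]; linarith
  · rw [hhigh _ (by linarith) (by linarith)]
  · rw [expLoss_hard hp]
    simp only [nvLoss]
    rw [max_eq_right (by linarith : 0 - (ζ + H) ≤ 0), max_eq_left (by linarith : 0 ≤ ζ + H - 0),
      sub_self,
      max_eq_left (by linarith : 0 ≤ ζ + H - ζ), max_eq_right (by linarith : ζ - (ζ + H) ≤ 0),
      max_eq_left (by linarith : 0 ≤ 3 * ζ + H - (ζ + H)),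
      max_eq_right (by linarith : ζ + H - (3 * ζ + H) ≤ 0)]
    have h1 : 0 < (q - τ - e) * ((1 - q) * H) := mul_pos (by linarith) (mul_pos (by linarith) hH)
    have h2 : 0 ≤ τ * ((1 - q) * (ζ + H)) := mul_nonneg hτ (mul_nonneg (by linarith) (by linarith))
    have h3 : 0 ≤ τ * (q * (2 * ζ)) := by positivity
    simp only [max_self]
    linarith
  · rw [expLoss_hard hp]
    simp only [nvLoss]
    rw [max_eq_right (by linarith : 0 - (ζ + H) ≤ 0), max_eq_left (by linarith : 0 ≤ ζ + H - 0),
      sub_self,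
      max_eq_left (by linarith : 0 ≤ ζ + H - ζ), max_eq_right (by linarith : ζ - (ζ + H) ≤ 0),
      max_eq_left (by linarith : 0 ≤ 3 * ζ + H - (ζ + H)),
      max_eq_right (by linarith : ζ + H - (3 * ζ + H) ≤ 0)]
    simp only [max_self]
    have h1 : 0 ≤ e * ((1 - q) * H) := mul_nonneg he.le (mul_nonneg (by linarith) hH.le)
    have h2 : 0 ≤ (1 - q) * (τ * ζ) := mul_nonneg (by linarith) (by positivity)
    linarith
  · intro A hA
    rw [expLoss_hard hp, expLoss_hard hp]
    have g := fun z => nvLoss_sub_ge_of_ge (z := z) hq0.le hq1.le (by linarith : A ≤ ζ + H)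
    have g0 := g 0
    have g1 := g ζ
    have g2 := g (ζ + H)
    have g3 := g (3 * ζ + H)
    rw [if_pos (by linarith)] at g0 g1
    rw [if_neg (by linarith)] at g2 g3
    have m0 := mul_le_mul_of_nonneg_left g0 hτ
    have m1 := mul_le_mul_of_nonneg_left g1 (by linarith : 0 ≤ q - τ + -e)
    have m2 := mul_le_mul_of_nonneg_left g2 (by linarith : 0 ≤ 1 - q - τ - -e)
    have m3 := mul_le_mul_of_nonneg_left g3 hτ
    have m := mul_le_mul_of_nonneg_left (by linarith : H / 2 ≤ ζ + H - A) he.le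
    linarith

/-- Multiplicative-regret lower bound, high-probability version. For every
(possibly randomized) data-driven algorithm mapping `n` iid samples (and internal
randomness) to a nonnegative decision, there is a `(β,γ,ζ)`-clustered distribution on
`[0,∞)` with `F(a*−ζ) ≥ τ` and `F(a*+ζ) ≤ 1−τ` on which, with probability at least `1/3`,
`(L(A) − L(a*))/L(a*) ≥ (1/(16γζτ + 8q(1−q)))·((q−τ)(1−q−τ)/(3√n))^{(β+2)/(β+1)}`. -/
theorem newsvendor_multiplicative_regret_lower_bound
    (q β γ ζ τ : ℝ) (hq : q ∈ Ioo (0:ℝ) 1) (hβ : 0 ≤ β) (hγ : 0 < γ)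
    (hζ : ζ ∈ Ioo 0 ((min q (1 - q)) ^ ((1:ℝ)/(β+1)) / γ))
    (hτ : τ ∈ Icc 0 (min q (1 - q) - (γ*ζ) ^ (β+1)))
    (n : ℕ) (hn : 1 ≤ n)
    (Ω : Type) [MeasurableSpace Ω] (ν : Measure Ω) [IsProbabilityMeasure ν]
    (alg : (Fin n → ℝ) × Ω → ℝ) (halg : Measurable alg) (halg0 : ∀ p, 0 ≤ alg p) :
    ∃ μ : Measure ℝ, IsProbabilityMeasure μ ∧ μ (Iio 0) = 0 ∧
      Integrable (fun z => z) μ ∧ Clustered q β γ ζ μ ∧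
      τ ≤ cdf' μ (optDec q μ - ζ) ∧ cdf' μ (optDec q μ + ζ) ≤ 1 - τ ∧
      (1 : ENNReal)/3 ≤ ((iid μ n).prod ν)
        {p | (1/(16*γ*ζ*τ + 8*q*(1-q)))
                * ((q-τ)*(1-q-τ)/(3*Real.sqrt n)) ^ ((β+2)/(β+1))
              ≤ (expLoss q μ (alg p) - expLoss q μ (optDec q μ))
                  / expLoss q μ (optDec q μ)} := by
  obtain ⟨hq0, hq1⟩ := hq
  obtain ⟨hζ0, -⟩ := hζ
  obtain ⟨hτ0, hτ1⟩ := hτ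
  have hb : 0 < β + 1 := by linarith
  have hx : (γ * ζ) ^ (β + 1) ≤ q - τ := by linarith [min_le_left q (1 - q)]
  have hy : (γ * ζ) ^ (β + 1) ≤ 1 - q - τ := by linarith [min_le_right q (1 - q)]
  have hγζ : 0 < (γ * ζ) ^ (β + 1) := by positivity
  have hx0 : 0 < q - τ := hγζ.trans_le hx
  have hy0 : 0 < 1 - q - τ := hγζ.trans_le hy
  have hn1 : (1 : ℝ) ≤ n := by exact_mod_cast hn
  have hs1 : 1 ≤ Real.sqrt n := Real.one_le_sqrt.2 hn1
  have hs0 : 0 < Real.sqrt n := by linarith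
  obtain ⟨e, hed⟩ : ∃ e, e = (q - τ) * (1 - q - τ) / (3 * Real.sqrt n) := ⟨_, rfl⟩
  have he : 0 < e := by rw [hed]; positivity
  have hsq : e ^ 2 = ((q - τ) * (1 - q - τ)) ^ 2 / (9 * n) := by
    rw [hed, div_pow, mul_pow 3, Real.sq_sqrt (by positivity)]
    norm_num
  have he3 : e ≤ (q - τ) * (1 - q - τ) / 3 := by
    rw [hed]
    exact div_le_div_of_nonneg_left (by positivity) (by norm_num) (by linarith)
  have hex : e ≤ (q - τ) / 3 := by nlinarith
  have hey : e ≤ (1 - q - τ) / 3 := by nlinarith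
  obtain ⟨H, hHd⟩ : ∃ H, H = e ^ (1 / (β + 1)) / γ := ⟨_, rfl⟩
  have hH : 0 < H := by rw [hHd]; positivity
  have hγH : γ * H = e ^ (1 / (β + 1)) := by rw [hHd]; field_simp
  have heH : (γ * H) ^ (β + 1) = e := by
    rw [hγH, ← Real.rpow_mul he.le, one_div_mul_cancel hb.ne', Real.rpow_one]
  have hγH1 : γ * H ≤ 1 := by
    rw [hγH]
    exact Real.rpow_le_one he.le (by linarith) (by positivity)
  have hpow : e ^ ((β + 2) / (β + 1)) = e * (γ * H) := by
    rw [hγH, show (β + 2) / (β + 1) = 1 + 1 / (β + 1) by field_simp; ring,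
      Real.rpow_add he, Real.rpow_one]
  have hqq : 0 < q * (1 - q) := mul_pos hq0 (by linarith)
  have hratio : ∀ R L : ℝ, 0 < L → L ≤ 2 * ζ * τ + q * (1 - q) * H → e * H / 2 ≤ R →
      1 / (16 * γ * ζ * τ + 8 * q * (1 - q)) *
        ((q - τ) * (1 - q - τ) / (3 * Real.sqrt n)) ^ ((β + 2) / (β + 1)) ≤ R / L := by
    intro R L hL hLle hR
    have hK : 0 < 16 * γ * ζ * τ + 8 * q * (1 - q) := by
      have : 0 ≤ 16 * γ * ζ * τ := by positivity
      nlinarith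
    rw [← hed, hpow, one_div, inv_mul_eq_div, div_le_div_iff₀ hK hL]
    have h1 : γ * L ≤ 2 * (γ * ζ * τ) + q * (1 - q) := by
      have := mul_le_mul_of_nonneg_left hLle hγ.le
      have := mul_le_mul_of_nonneg_left hγH1 hqq.le
      linarith
    have h2 : 0 ≤ γ * ζ * τ := by positivity
    have h3 := mul_le_mul_of_nonneg_left h1 (by positivity : 0 ≤ e * H)
    have h4 := mul_le_mul_of_nonneg_right hR hK.le
    have h5 : 0 ≤ e * H * (γ * ζ * τ) := by positivity
    have h6 : 0 ≤ e * H * (q * (1 - q)) := by positivity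
    linarith
  obtain ⟨μ₁, hμ₁, hopt₁, hclu₁, hl₁, hr₁, hpos₁, hle₁, hreg₁⟩ :=
    hard_pos_spec hq0 hq1 hβ hγ hζ0 hτ0 hH he heH hx hy (by linarith)
  obtain ⟨μ₂, hμ₂, hopt₂, hclu₂, hl₂, hr₂, hpos₂, hle₂, hreg₂⟩ :=
    hard_neg_spec hq0 hq1 hβ hγ hζ0 hτ0 hH he heH hx hy (by linarith)
  have hp₁ := hardWeights_nonneg (e := e) hτ0 (by linarith : 0 ≤ q - τ + e) (by linarith)
  have hp₂ := hardWeights_nonneg (e := -e) hτ0 (by linarith : 0 ≤ q - τ + -e) (by linarith)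
  have hE : MeasurableSet {p | ζ + H / 2 ≤ alg p} := measurableSet_le measurable_const halg
  have hprob₁ : IsProbabilityMeasure μ₁ := by
    rw [hμ₁]; exact isProbabilityMeasure_atomicLaw hp₁ sum_hardWeights
  have hprob₂ : IsProbabilityMeasure μ₂ := by
    rw [hμ₂]; exact isProbabilityMeasure_atomicLaw hp₂ sum_hardWeights
  have hpiprob₂ : IsProbabilityMeasure (iid μ₂ n) := by unfold iid; infer_instance
  have hclose : ((iid μ₂ n).prod ν) {p | ζ + H / 2 ≤ alg p} ≤
      ((iid μ₁ n).prod ν) {p | ζ + H / 2 ≤ alg p} + 1 / 3 := by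
    rw [hμ₁, hμ₂, iid_atomicLaw_prod_apply hp₁ sum_hardWeights n ν hE,
      iid_atomicLaw_prod_apply hp₂ sum_hardWeights n ν hE,
      show (1 / 3 : ENNReal) = ENNReal.ofReal (1 / 3) by
        rw [ENNReal.ofReal_div_of_pos (by norm_num)]; simp,
      ← ENNReal.ofReal_add _ (by norm_num)]
    · refine ENNReal.ofReal_le_ofReal ?_
      have := sum_prod_mul_sub_le hn hp₂ (p := hardWeights q τ e)
        (by
          intro i h
          fin_cases i
          · simpa [hardWeights] using h
          · simp [hardWeights] at h; linarith
          · simp [hardWeights] at h; linarith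
          · simpa [hardWeights] using h)
        sum_hardWeights sum_hardWeights (chiSq_hardWeights_le hn hτ0 hx0 hy0 he hsq hex)
        (g := fun s => ν.real (Prod.mk (fun i => hardNodes ζ H (s i)) ⁻¹'
          {p | ζ + H / 2 ≤ alg p}))
        (fun _ => measureReal_nonneg) (fun _ => measureReal_le_one)
      linarith
    · exact Finset.sum_nonneg fun s _ =>
        mul_nonneg (Finset.prod_nonneg fun i _ => hp₁ _) measureReal_nonneg
  by_cases hcase : (1 : ENNReal) / 3 ≤ ((iid μ₁ n).prod ν) {p | ζ + H / 2 ≤ alg p}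
  · refine ⟨μ₁, hprob₁, ?_, ?_, hclu₁, by rwa [hopt₁], by rwa [hopt₁], ?_⟩
    · rw [hμ₁]; exact atomicLaw_hard_Iio_zero hζ0 hH
    · rw [hμ₁]; exact integrable_atomicLaw measurable_id
    · rw [hopt₁]
      exact hcase.trans (measure_mono fun p hp => hratio _ _ hpos₁ hle₁ (hreg₁ _ hp))
  · refine ⟨μ₂, hprob₂, ?_, ?_, hclu₂, by rwa [hopt₂], by rwa [hopt₂], ?_⟩
    · rw [hμ₂]; exact atomicLaw_hard_Iio_zero hζ0 hH
    · rw [hμ₂]; exact integrable_atomicLaw measurable_id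
    · rw [hopt₂]
      have hcompl : (1 : ENNReal) / 3 ≤ ((iid μ₂ n).prod ν) {p | ζ + H / 2 ≤ alg p}ᶜ := by
        rw [prob_compl_eq_one_sub hE]
        have h23 : ((iid μ₂ n).prod ν) {p | ζ + H / 2 ≤ alg p} ≤ 1 / 3 + 1 / 3 :=
          hclose.trans (by gcongr; exact (not_le.1 hcase).le)
        refine le_trans ?_ (tsub_le_tsub_left h23 1)
        rw [show (1 / 3 : ENNReal) = ENNReal.ofReal (1 / 3) by
            rw [ENNReal.ofReal_div_of_pos (by norm_num)]; simp,
          ← ENNReal.ofReal_add (by norm_num) (by norm_num), ← ENNReal.ofReal_one,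
          ← ENNReal.ofReal_sub _ (by norm_num)]
        exact ENNReal.ofReal_le_ofReal (by norm_num)
      refine hcompl.trans (measure_mono fun p hp => hratio _ _ hpos₂ hle₂ (hreg₂ _ ?_))
      exact (lt_of_not_ge (mem_compl_iff _ _ |>.1 hp)).le
end
end

section
/- Fix q ∈ (0,1) and γ ∈ (0,∞). For every (possibly randomized) data-driven algorithm that maps n IID demand samples to a decision A ≥ 0, there exists a continuous probability distribution whose density is at least γ on an interval contained in [0,1] (and which is supported on that interval), with CDF F, optimal decision a*, and expected loss L, such that with probability at least 1/3, the additive regret satisfies L(A) − L(a*) ≥ q²(1−q)² / (72·max{γ,1}·n). -/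
open MeasureTheory Set

noncomputable section

theorem withDensity_ofReal_apply {α : Type*} [MeasurableSpace α] {μ : Measure α} {f : α → ℝ}
    (hf : Integrable f μ) (hf0 : ∀ x, 0 ≤ f x) {s : Set α} (hs : MeasurableSet s) :
    μ.withDensity (fun x => ENNReal.ofReal (f x)) s = ENNReal.ofReal (∫ x in s, f x ∂μ) := by
  rw [withDensity_apply _ hs,
    ofReal_integral_eq_lintegral_ofReal hf.integrableOn (Filter.Eventually.of_forall hf0)]

theorem two_thirds_le_add_compl {α : Type*} [MeasurableSpace α] {μ : Measure α}
    [IsProbabilityMeasure μ] {f : α → ℝ} (hf : Integrable f μ) (hf0 : ∀ x, 0 ≤ f x)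
    (hf2 : Integrable (fun x => f x ^ 2) μ) (h1 : ∫ x, f x ∂μ = 1)
    (h2 : ∫ x, f x ^ 2 ∂μ ≤ 6 / 5) {s : Set α} (hs : MeasurableSet s) :
    2 / 3 ≤ μ.real s + (μ.withDensity fun x => ENNReal.ofReal (f x)).real sᶜ := by
  have e1 : (μ.withDensity fun x => ENNReal.ofReal (f x)).real sᶜ
      = ∫ x, sᶜ.indicator f x ∂μ := by
    rw [Measure.real, withDensity_ofReal_apply hf hf0 hs.compl, integral_indicator hs.compl,
      ENNReal.toReal_ofReal (integral_nonneg hf0)]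
  have e2 : μ.real s = ∫ x, s.indicator (fun _ => (1 : ℝ)) x ∂μ := by
    rw [integral_indicator hs]; simp
  have i1 : Integrable (sᶜ.indicator f) μ := hf.indicator hs.compl
  have i2 : Integrable (s.indicator (fun _ => (1 : ℝ))) μ := (integrable_const 1).indicator hs
  rw [e1, e2, ← integral_add i2 i1]
  have i3 : Integrable (fun x => 3 / 2 * f x - 1 / 2 * f x ^ 2) μ :=
    (hf.const_mul _).sub (hf2.const_mul _)
  have key : ∫ x, (3 / 2 * f x - 1 / 2 * f x ^ 2 - 1 / 8) ∂μ
      ≤ ∫ x, (s.indicator (fun _ => (1 : ℝ)) x + sᶜ.indicator f x) ∂μ := by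
    refine integral_mono (i3.sub (integrable_const _)) (i2.add i1) fun x => ?_
    by_cases hx : x ∈ s
    · simp only [indicator_of_mem hx, indicator_of_notMem (notMem_compl_iff.2 hx)]
      nlinarith [sq_nonneg (f x - 3 / 2)]
    · simp only [indicator_of_notMem hx, indicator_of_mem (mem_compl hx)]
      nlinarith [sq_nonneg (f x - 1 / 2)]
  rw [integral_sub i3 (integrable_const _), integral_sub (hf.const_mul _) (hf2.const_mul _),
    integral_const_mul, integral_const_mul, h1] at key
  simp at key
  linarith

theorem pi_withDensity_ofReal {ι α : Type*} [Fintype ι] [MeasurableSpace α] {μ : Measure α}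
    [IsProbabilityMeasure μ] {r : α → ℝ} (hr : Integrable r μ) (hr0 : ∀ x, 0 ≤ r x) :
    Measure.pi (fun _ : ι => μ.withDensity fun x => ENNReal.ofReal (r x))
      = (Measure.pi fun _ : ι => μ).withDensity fun x => ENNReal.ofReal (∏ i, r (x i)) := by
  have := isFiniteMeasure_withDensity_ofReal hr.2
  refine Measure.pi_eq fun s hs => ?_
  rw [withDensity_ofReal_apply (Integrable.fintype_prod fun _ => hr)
    (fun x => Finset.prod_nonneg fun i _ => hr0 _) (MeasurableSet.univ_pi hs),
    Measure.restrict_pi_pi, integral_fintype_prod_eq_prod (fun _ => r),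
    ENNReal.ofReal_prod_of_nonneg fun i _ => integral_nonneg hr0]
  exact Finset.prod_congr rfl fun i _ => (withDensity_ofReal_apply hr hr0 (hs i)).symm

theorem one_add_inv_pow_le (n : ℕ) (hn : 1 ≤ n) : (1 + 1 / (6 * n) : ℝ) ^ n ≤ 6 / 5 := by
  have hn' : (0 : ℝ) < n := by exact_mod_cast hn
  have h1 : (1 + 1 / (6 * n) : ℝ) ^ n ≤ Real.exp (1 / 6) := by
    calc (1 + 1 / (6 * n) : ℝ) ^ n ≤ (Real.exp (1 / (6 * n))) ^ n := by
          gcongr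
          linarith [Real.add_one_le_exp (1 / (6 * n) : ℝ)]
      _ = Real.exp (1 / 6) := by
          rw [← Real.exp_nat_mul]; congr 1; field_simp
  have h2 := Real.add_one_le_exp (-(1 / 6) : ℝ)
  have h3 : Real.exp (1 / 6) * Real.exp (-(1 / 6)) = 1 := by rw [← Real.exp_add]; simp
  nlinarith [Real.exp_pos (1 / 6)]

theorem two_thirds_le_iid_add_compl {α Ω : Type*} [MeasurableSpace α] [MeasurableSpace Ω]
    {μ : Measure α} [IsProbabilityMeasure μ] (ν : Measure Ω) [IsProbabilityMeasure ν] {r : α → ℝ}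
    (hr : Integrable r μ) (hr0 : ∀ x, 0 ≤ r x) (hr2 : Integrable (fun x => r x ^ 2) μ)
    (h1 : ∫ x, r x ∂μ = 1) {n : ℕ} (hn : 1 ≤ n) (h2 : ∫ x, r x ^ 2 ∂μ ≤ 1 + 1 / (6 * n))
    {s : Set ((Fin n → α) × Ω)} (hs : MeasurableSet s) :
    2 / 3 ≤ ((Measure.pi fun _ : Fin n => μ).prod ν).real s
      + ((Measure.pi fun _ : Fin n =>
          μ.withDensity fun x => ENNReal.ofReal (r x)).prod ν).real sᶜ := by
  have hp : Integrable (fun x : Fin n → α => ∏ i, r (x i)) (Measure.pi fun _ => μ) :=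
    Integrable.fintype_prod fun _ => hr
  have hp2 : Integrable (fun x : Fin n → α => ∏ i, r (x i) ^ 2) (Measure.pi fun _ => μ) :=
    Integrable.fintype_prod fun _ => hr2
  have tr : ∀ g : (Fin n → α) → ℝ, Integrable g (Measure.pi fun _ => μ) →
      ∫ p, g p.1 ∂((Measure.pi fun _ : Fin n => μ).prod ν) = ∫ x, g x ∂(Measure.pi fun _ => μ) := by
    intro g hg
    rw [integral_prod _ (hg.comp_fst ν)]
    simp
  rw [pi_withDensity_ofReal hr hr0]
  have e := prod_withDensity_left₀ (μ := Measure.pi fun _ : Fin n => μ) (ν := ν)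
    hp.aemeasurable.ennreal_ofReal
  rw [e]
  have i1 : Integrable (fun p : (Fin n → α) × Ω => ∏ i, r (p.1 i))
      ((Measure.pi fun _ : Fin n => μ).prod ν) := hp.comp_fst ν
  have i2 : Integrable (fun p : (Fin n → α) × Ω => (∏ i, r (p.1 i)) ^ 2)
      ((Measure.pi fun _ : Fin n => μ).prod ν) := by
    simp_rw [← Finset.prod_pow]
    exact hp2.comp_fst ν
  have e1 : ∫ p, (∏ i, r (p.1 i)) ∂((Measure.pi fun _ : Fin n => μ).prod ν) = 1 := by
    rw [tr _ hp, integral_fintype_prod_eq_pow r, h1, one_pow]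
  have e2 : ∫ p, (∏ i, r (p.1 i)) ^ 2 ∂((Measure.pi fun _ : Fin n => μ).prod ν) ≤ 6 / 5 := by
    simp_rw [← Finset.prod_pow]
    rw [tr _ hp2, integral_fintype_prod_eq_pow (fun x => r x ^ 2), Fintype.card_fin]
    exact (pow_le_pow_left₀ (integral_nonneg fun x => sq_nonneg _) h2 n).trans
      (one_add_inv_pow_le n hn)
  exact two_thirds_le_add_compl i1 (fun p => Finset.prod_nonneg fun i _ => hr0 _) i2 e1 e2 hs

/-- The measure with density `A` on `[0, t]` and density `B` on `(t, w]`. -/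
def twoStep (A B t w : ℝ) : Measure ℝ :=
  ENNReal.ofReal A • volume.restrict (Icc 0 t) + ENNReal.ofReal B • volume.restrict (Ioc t w)

/-- The density of `twoStep A B t w`. -/
def twoStepDensity (A B t w z : ℝ) : ℝ :=
  (Icc 0 t).indicator (fun _ => A) z + (Ioc t w).indicator (fun _ => B) z

theorem measurable_twoStepDensity (A B t w : ℝ) : Measurable (twoStepDensity A B t w) :=
  (measurable_const.indicator measurableSet_Icc).add (measurable_const.indicator measurableSet_Ioc)

theorem twoStep_eq_withDensity {A B t w : ℝ} (hA : 0 ≤ A) (hB : 0 ≤ B) :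
    twoStep A B t w = volume.withDensity fun z => ENNReal.ofReal (twoStepDensity A B t w z) := by
  have h : (fun z => ENNReal.ofReal (twoStepDensity A B t w z))
      = (Icc 0 t).indicator (fun _ => ENNReal.ofReal A)
        + (Ioc t w).indicator (fun _ => ENNReal.ofReal B) := by
    funext z
    rw [twoStepDensity, ENNReal.ofReal_add (indicator_nonneg (fun _ _ => hA) _)
      (indicator_nonneg (fun _ _ => hB) _)]
    by_cases h1 : z ∈ Icc 0 t <;> by_cases h2 : z ∈ Ioc t w <;> simp [h1, h2, indicator]
  rw [h, withDensity_add_left (measurable_const.indicator measurableSet_Icc),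
    withDensity_indicator measurableSet_Icc, withDensity_indicator measurableSet_Ioc,
    withDensity_const, withDensity_const, twoStep]

theorem isProbabilityMeasure_twoStep {A B t w : ℝ} (hA : 0 ≤ A) (hB : 0 ≤ B) (ht : 0 ≤ t)
    (htw : t ≤ w) (h : A * t + B * (w - t) = 1) : IsProbabilityMeasure (twoStep A B t w) := by
  constructor
  simp only [twoStep, Measure.add_apply, Measure.smul_apply, Measure.restrict_apply_univ,
    Real.volume_Icc, Real.volume_Ioc, smul_eq_mul, sub_zero]
  rw [← ENNReal.ofReal_mul hA, ← ENNReal.ofReal_mul hB, ← ENNReal.ofReal_add (by positivity)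
    (mul_nonneg hB (by linarith)), h, ENNReal.ofReal_one]

theorem cdf'_twoStep {A B t w : ℝ} (hA : 0 ≤ A) (hB : 0 ≤ B) (a : ℝ) :
    cdf' (twoStep A B t w) a = A * max (min t a) 0 + B * max (min w a - t) 0 := by
  simp only [cdf', twoStep, Measure.add_apply, Measure.smul_apply, smul_eq_mul,
    Measure.restrict_apply measurableSet_Iic]
  have h1 : Iic a ∩ Icc 0 t = Icc 0 (min t a) := by
    ext z; simp only [mem_inter_iff, mem_Iic, mem_Icc, le_min_iff]; tauto
  have h2 : Iic a ∩ Ioc t w = Ioc t (min w a) := by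
    ext z; simp only [mem_inter_iff, mem_Iic, mem_Ioc, le_min_iff]; tauto
  rw [h1, h2, Real.volume_Icc, Real.volume_Ioc, ENNReal.toReal_add (by finiteness) (by finiteness)]
  rw [ENNReal.toReal_mul, ENNReal.toReal_mul, sub_zero]
  simp only [ENNReal.toReal_ofReal', max_eq_left hA, max_eq_left hB]

theorem integrable_twoStep_of_continuous {A B t w : ℝ} {g : ℝ → ℝ} (hg : Continuous g) :
    Integrable g (twoStep A B t w) :=
  (hg.integrableOn_Icc.smul_measure ENNReal.ofReal_ne_top).add_measure
    (hg.integrableOn_Ioc.smul_measure ENNReal.ofReal_ne_top)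

theorem twoStep_eq_withDensity_twoStep {A B A' B' t w : ℝ} (hA : 0 < A) (hB : 0 < B) (hA' : 0 ≤ A')
    (hB' : 0 ≤ B') : twoStep A' B' t w = (twoStep A B t w).withDensity
      fun z => ENNReal.ofReal (if z ≤ t then A' / A else B' / B) := by
  rw [twoStep_eq_withDensity hA.le hB.le, twoStep_eq_withDensity hA' hB', ← withDensity_mul _
    (measurable_twoStepDensity A B t w).ennreal_ofReal
    (Measurable.ite measurableSet_Iic measurable_const measurable_const).ennreal_ofReal]
  congr 1
  funext z
  rw [Pi.mul_apply, mul_comm, ← ENNReal.ofReal_mul (by split_ifs <;> positivity)]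
  congr 1
  by_cases hz : z ≤ t
  · simp only [twoStepDensity, indicator, mem_Icc, mem_Ioc, hz, not_lt.2 hz, if_true]
    split_ifs <;> simp_all [hA.ne']
  · simp only [twoStepDensity, indicator, mem_Icc, mem_Ioc, hz, not_le.1 hz]
    split_ifs <;> simp_all [hB.ne']

theorem integral_ite_le {μ : Measure ℝ} [IsProbabilityMeasure μ] (t x y : ℝ) :
    ∫ z, (if z ≤ t then x else y) ∂μ = cdf' μ t * x + (1 - cdf' μ t) * y := by
  have h : (fun z => if z ≤ t then x else y)
      = fun z => (Iic t).indicator (fun _ => x - y) z + y := by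
    funext z; by_cases hz : z ≤ t <;> simp [hz]
  rw [h, integral_add ((integrable_const _).indicator measurableSet_Iic) (integrable_const _),
    integral_indicator measurableSet_Iic]
  simp [cdf', Measure.real]
  ring

theorem integrable_ite_le {μ : Measure ℝ} [IsFiniteMeasure μ] (t x y : ℝ) :
    Integrable (fun z => if z ≤ t then x else y) μ :=
  Integrable.of_bound (Measurable.ite measurableSet_Iic measurable_const
    measurable_const).aestronglyMeasurable (max |x| |y|)
    (Filter.Eventually.of_forall fun z => by split_ifs <;> simp)

theorem mul_cdf'_sub_le_expLoss_sub {q : ℝ} {μ : Measure ℝ} [IsProbabilityMeasure μ]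
    (hi : ∀ a, Integrable (nvLoss q a) μ) (a b : ℝ) :
    (a - b) * (cdf' μ b - q) ≤ expLoss q μ a - expLoss q μ b := by
  have h : ∫ z, (if z ≤ b then (a - b) * (1 - q) else (a - b) * (-q)) ∂μ
      ≤ ∫ z, (nvLoss q a z - nvLoss q b z) ∂μ := by
    refine integral_mono (integrable_ite_le _ _ _) ((hi a).sub (hi b)) fun z => ?_
    have hm : ∀ x, max (z - x) 0 = z - x + max (x - z) 0 := fun x => by
      rcases max_cases (z - x) 0 with h1 | h1 <;> rcases max_cases (x - z) 0 with h2 | h2 <;>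
      linarith
    simp only [nvLoss, hm]
    rcases max_cases (a - z) 0 with h2 | h2 <;> rcases max_cases (b - z) 0 with h4 | h4 <;>
    rw [h2.1, h4.1] <;> split_ifs <;> linarith
  rw [integral_ite_le, integral_sub (hi a) (hi b)] at h
  unfold expLoss
  linarith

theorem optDec_eq_s15 {q : ℝ} {μ : Measure ℝ} {b : ℝ} (hb : 0 ≤ b) (hqb : q ≤ cdf' μ b)
    (h : ∀ a, 0 ≤ a → a < b → cdf' μ a < q) : optDec q μ = b :=
  IsLeast.csInf_eq ⟨⟨hb, hqb⟩, fun a ha => le_of_not_gt fun hab => (h a ha.1 hab).not_ge ha.2⟩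

theorem regret_ge {q : ℝ} {μ : Measure ℝ} [IsProbabilityMeasure μ]
    (hi : ∀ a, Integrable (nvLoss q a) μ) {a t b : ℝ} (hb : cdf' μ b = q)
    (ha : 0 ≤ (a - t) * (cdf' μ t - q)) :
    (t - b) / 2 * (cdf' μ ((t + b) / 2) - q) ≤ expLoss q μ a - expLoss q μ b := by
  have h1 := mul_cdf'_sub_le_expLoss_sub hi a t
  have h2 := mul_cdf'_sub_le_expLoss_sub hi t ((t + b) / 2)
  have h3 := mul_cdf'_sub_le_expLoss_sub hi ((t + b) / 2) b
  rw [hb, sub_self, mul_zero] at h3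
  linarith

theorem integrable_nvLoss_twoStep (q A B t w a : ℝ) :
    Integrable (nvLoss q a) (twoStep A B t w) :=
  integrable_twoStep_of_continuous (by unfold nvLoss; fun_prop)

theorem regret_twoStep_of_ge {q A B t w δ a : ℝ} [IsProbabilityMeasure (twoStep A B t w)]
    (hA : 0 < A) (hB : 0 ≤ B) (htw : t ≤ w) (hq : 0 < q) (hδ : 0 < δ) (hAt : A * t = q + δ)
    (ha : t ≤ a) : δ ^ 2 / (4 * A) ≤ expLoss q (twoStep A B t w) a
      - expLoss q (twoStep A B t w) (optDec q (twoStep A B t w)) := by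
  have hF : ∀ x, 0 ≤ x → x ≤ t → cdf' (twoStep A B t w) x = A * x := fun x hx hxt => by
    rw [cdf'_twoStep hA.le hB, min_eq_right hxt, min_eq_right (hxt.trans htw), max_eq_left hx,
      max_eq_right (by linarith), mul_zero, add_zero]
  have ht : t = q / A + δ / A := by field_simp; linarith
  have hb : 0 < q / A := by positivity
  have hd : 0 < δ / A := by positivity
  have hFb : cdf' (twoStep A B t w) (q / A) = q := by
    rw [hF _ hb.le (by linarith)]; field_simp
  rw [optDec_eq_s15 hb.le hFb.ge fun x hx hxb => by
    rw [hF x hx (by linarith)]; rwa [lt_div_iff₀' hA] at hxb]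
  have h := regret_ge (integrable_nvLoss_twoStep q A B t w) (a := a) (t := t) hFb (by
    rw [hF t (by linarith) le_rfl, hAt]
    exact mul_nonneg (by linarith) (by linarith))
  rw [hF _ (by linarith) (by linarith)] at h
  refine le_trans (le_of_eq ?_) h
  rw [ht]
  field_simp
  ring

theorem regret_twoStep_of_le {q A B t w δ a : ℝ} [IsProbabilityMeasure (twoStep A B t w)]
    (hA : 0 ≤ A) (hB : 0 < B) (ht : 0 ≤ t) (hδ : 0 < δ) (hAt : A * t = q - δ)
    (hBw : δ ≤ B * (w - t)) (ha : a ≤ t) : δ ^ 2 / (4 * B) ≤ expLoss q (twoStep A B t w) a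
      - expLoss q (twoStep A B t w) (optDec q (twoStep A B t w)) := by
  have hF : ∀ x, t ≤ x → x ≤ w → cdf' (twoStep A B t w) x = q - δ + B * (x - t) :=
    fun x hx hxt => by
      rw [cdf'_twoStep hA hB.le, min_eq_left hx, min_eq_right hxt, max_eq_left ht,
        max_eq_left (by linarith), hAt]
  have hd : 0 < δ / B := by positivity
  have hdw : δ / B ≤ w - t := by rwa [div_le_iff₀' hB]
  have hFb : cdf' (twoStep A B t w) (t + δ / B) = q := by
    rw [hF _ (by linarith) (by linarith)]; field_simp; ring
  rw [optDec_eq_s15 (by linarith) hFb.ge fun x hx hxb => by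
    rcases le_total t x with h | h
    · have h' : x - t < δ / B := by linarith
      rw [lt_div_iff₀' hB] at h'
      rw [hF x h (by linarith)]
      linarith
    · rw [cdf'_twoStep hA hB.le, min_eq_right h, min_eq_right (by linarith), max_eq_left hx,
        max_eq_right (by linarith)]
      linarith [mul_le_mul_of_nonneg_left h hA]]
  have h := regret_ge (integrable_nvLoss_twoStep q A B t w) (a := a) (t := t) hFb (by
    rw [hF t le_rfl (by linarith)]
    exact mul_nonneg_of_nonpos_of_nonpos (by linarith) (by linarith))
  rw [hF _ (by linarith) (by linarith)] at h
  refine le_trans (le_of_eq ?_) h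
  field_simp
  ring

/-- Second moment of the likelihood ratio between Bernoulli laws with parameters `q ± δ`. -/
theorem bernoulli_second_moment_le {q δ : ℝ} {n : ℕ} (hq : 0 < q) (hn : 1 ≤ n)
    (hδ : 0 < δ) (h2 : 3 * δ ≤ 1 - q)
    (hsq : δ ^ 2 = q ^ 2 * (1 - q) ^ 2 / (9 * n)) :
    (q + δ) * ((q - δ) / (q + δ)) ^ 2 + (1 - (q + δ)) * ((1 - q + δ) / (1 - q - δ)) ^ 2
      ≤ 1 + 1 / (6 * n) := by
  have hn' : (0 : ℝ) < n := by exact_mod_cast hn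
  have hp : 0 < q + δ := by linarith
  have hp' : 0 < 1 - q - δ := by linarith
  have e : (q + δ) * ((q - δ) / (q + δ)) ^ 2 + (1 - (q + δ)) * ((1 - q + δ) / (1 - q - δ)) ^ 2
      = 1 + 4 * δ ^ 2 / ((q + δ) * (1 - q - δ)) := by
    field_simp
    ring
  rw [e, hsq]
  have hb : 2 / 3 * (q * (1 - q)) ≤ (q + δ) * (1 - q - δ) := by nlinarith
  have hq4 : q * (1 - q) ≤ 1 / 4 := by nlinarith [sq_nonneg (q - 1 / 2)]
  have hq0 : 0 < q * (1 - q) := mul_pos hq (by linarith)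
  have : 4 * (q ^ 2 * (1 - q) ^ 2 / (9 * n)) / ((q + δ) * (1 - q - δ)) ≤ 1 / (6 * n) := by
    rw [div_le_iff₀ (by positivity)]
    calc 4 * (q ^ 2 * (1 - q) ^ 2 / (9 * n))
        = 8 / 3 * (q * (1 - q)) * (q * (1 - q)) * (1 / (6 * n)) := by field_simp; ring
      _ ≤ (q + δ) * (1 - q - δ) * (1 / (6 * n)) := by
          refine mul_le_mul_of_nonneg_right ?_ (by positivity)
          nlinarith
      _ = _ := by ring
  linarith

/-- Continuous lower bound (`β = 0` case), high-probability version. For every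
(possibly randomized) data-driven algorithm mapping `n` iid samples (and internal
randomness) to a nonnegative decision, there is a continuous distribution whose density is
at least `γ` on an interval contained in `[0,1]` (and supported on that interval) on which,
with probability at least `1/3`, `L(A) − L(a*) ≥ q²(1−q)²/(72·max{γ,1}·n)`. -/
theorem newsvendor_continuous_additive_regret_lower_bound
    (q γ : ℝ) (hq : q ∈ Ioo (0:ℝ) 1) (hγ : 0 < γ)
    (n : ℕ) (hn : 1 ≤ n)
    (Ω : Type) [MeasurableSpace Ω] (ν : Measure Ω) [IsProbabilityMeasure ν]
    (alg : (Fin n → ℝ) × Ω → ℝ) (halg : Measurable alg) (halg0 : ∀ p, 0 ≤ alg p) :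
    ∃ (μ : Measure ℝ) (c d : ℝ) (f : ℝ → ℝ),
      IsProbabilityMeasure μ ∧ 0 ≤ c ∧ c < d ∧ d ≤ 1 ∧
      μ = volume.withDensity (fun z => ENNReal.ofReal (f z)) ∧
      (∀ z ∈ Icc c d, γ ≤ f z) ∧ (∀ z, z ∉ Icc c d → f z = 0) ∧
      (1 : ENNReal)/3 ≤ ((iid μ n).prod ν)
        {p | q^2 * (1-q)^2 / (72 * max γ 1 * n)
              ≤ expLoss q μ (alg p) - expLoss q μ (optDec q μ)} := by
  obtain ⟨hq0, hq1⟩ := hq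
  have hn' : (1 : ℝ) ≤ n := by exact_mod_cast hn
  obtain ⟨δ, hδ, hδq, hδq', hsq⟩ : ∃ δ : ℝ, 0 < δ ∧ 3 * δ ≤ q ∧ 3 * δ ≤ 1 - q ∧
      δ ^ 2 = q ^ 2 * (1 - q) ^ 2 / (9 * n) := by
    have hs : 1 ≤ √(n : ℝ) := Real.one_le_sqrt.2 hn'
    have hq2 : 0 < q * (1 - q) := mul_pos hq0 (by linarith)
    have hle : 3 * (q * (1 - q) / (3 * √n)) ≤ q * (1 - q) := by
      rw [show 3 * (q * (1 - q) / (3 * √n)) = q * (1 - q) / √n by field_simp]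
      exact div_le_self hq2.le hs
    refine ⟨q * (1 - q) / (3 * √n), by positivity, by nlinarith, by nlinarith, ?_⟩
    rw [div_pow, mul_pow, mul_pow, Real.sq_sqrt (by linarith)]
    norm_num
  generalize hg : max γ 1 = g
  have hgγ : γ ≤ g := hg ▸ le_max_left _ _
  have hg1 : 1 ≤ g := hg ▸ le_max_right _ _
  have hg0 : 0 < g := by linarith
  have hqδ : 0 < q - δ := by linarith
  have hqδ' : 0 < 1 - q - δ := by linarith
  obtain ⟨t, ht⟩ : ∃ t, t = (q - δ) / g := ⟨_, rfl⟩
  obtain ⟨w, hw⟩ : ∃ w, w = (1 - 2 * δ) / g := ⟨_, rfl⟩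
  have ht0 : 0 < t := ht ▸ by positivity
  have hwt : w - t = (1 - q - δ) / g := by rw [hw, ht]; ring
  have htw : t < w := by
    have : 0 < w - t := hwt ▸ by positivity
    linarith
  have hw1 : w ≤ 1 := by rw [hw, div_le_one hg0]; linarith
  obtain ⟨A, hA⟩ : ∃ A, A = g * ((q + δ) / (q - δ)) := ⟨_, rfl⟩
  obtain ⟨B, hB⟩ : ∃ B, B = g * ((1 - q + δ) / (1 - q - δ)) := ⟨_, rfl⟩
  have hgA : g ≤ A := hA ▸ le_mul_of_one_le_right hg0.le (by rw [one_le_div hqδ]; linarith)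
  have hgB : g ≤ B := hB ▸ le_mul_of_one_le_right hg0.le (by rw [one_le_div hqδ']; linarith)
  have hA2 : A ≤ g * 2 := by rw [hA]; gcongr; rw [div_le_iff₀ hqδ]; linarith
  have hB2 : B ≤ g * 2 := by rw [hB]; gcongr; rw [div_le_iff₀ hqδ']; linarith
  have hA0 : 0 < A := by linarith
  have hB0 : 0 < B := by linarith
  have hAt : A * t = q + δ := by rw [hA, ht]; field_simp
  have hgt : g * t = q - δ := by rw [ht]; field_simp
  have hgw : g * (w - t) = 1 - q - δ := by rw [hwt]; field_simp
  have hBw : B * (w - t) = 1 - q + δ := by rw [hwt, hB]; field_simp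
  have hP : IsProbabilityMeasure (twoStep A g t w) :=
    isProbabilityMeasure_twoStep hA0.le hg0.le ht0.le htw.le (by rw [hAt, hgw]; ring)
  have hQ : IsProbabilityMeasure (twoStep g B t w) :=
    isProbabilityMeasure_twoStep hg0.le hB0.le ht0.le htw.le (by rw [hgt, hBw]; ring)
  have hfge : ∀ A' B' : ℝ, g ≤ A' → g ≤ B' → ∀ z ∈ Icc 0 w, γ ≤ twoStepDensity A' B' t w z := by
    intro A' B' hA' hB' z hz
    rcases le_or_gt z t with h | h
    · simp only [twoStepDensity, indicator, mem_Icc, mem_Ioc, hz.1, h, not_lt.2 h]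
      simp; linarith
    · simp only [twoStepDensity, indicator, mem_Icc, mem_Ioc, hz.2, h, not_le.2 h]
      simp; linarith
  have hf0 : ∀ A' B' z : ℝ, z ∉ Icc 0 w → twoStepDensity A' B' t w z = 0 := by
    intro A' B' z hz
    rw [twoStepDensity, indicator_of_notMem fun h => hz ⟨h.1, h.2.trans htw.le⟩,
      indicator_of_notMem fun h => hz ⟨ht0.le.trans h.1.le, h.2⟩, add_zero]
  have hbound : ∀ x, 0 < x → x ≤ g * 2 →
      q ^ 2 * (1 - q) ^ 2 / (72 * g * n) ≤ δ ^ 2 / (4 * x) := by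
    intro x hx hxg
    calc q ^ 2 * (1 - q) ^ 2 / (72 * g * n) = δ ^ 2 / (4 * (g * 2)) := by
          rw [hsq]; field_simp; norm_num
      _ ≤ δ ^ 2 / (4 * x) := by gcongr
  have hE : MeasurableSet {p | t ≤ alg p} := measurableSet_le measurable_const halg
  have hcdf : cdf' (twoStep A g t w) t = q + δ := by
    rw [cdf'_twoStep hA0.le hg0.le, min_self, min_eq_right htw.le, sub_self, max_self, mul_zero,
      max_eq_left ht0.le, add_zero, hAt]
  have hrA : g / A = (q - δ) / (q + δ) := by rw [hA]; field_simp
  have hrB : B / g = (1 - q + δ) / (1 - q - δ) := by rw [hB]; field_simp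
  have key := two_thirds_le_iid_add_compl (μ := twoStep A g t w) ν
    (r := fun z => if z ≤ t then g / A else B / g) (integrable_ite_le _ _ _)
    (fun z => by split_ifs <;> positivity)
    (by simp only [ite_pow]; exact integrable_ite_le _ _ _)
    (by
      rw [integral_ite_le, hcdf, hrA, hrB]
      have : q + δ ≠ 0 := by positivity
      field_simp
      ring)
    hn
    (by
      simp only [ite_pow]
      rw [integral_ite_le, hcdf, hrA, hrB]
      exact bernoulli_second_moment_le hq0 hn hδ hδq' hsq) hE
  rw [← twoStep_eq_withDensity_twoStep hA0 hg0 hg0.le hB0.le] at key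
  have third : ∀ (m : Measure ((Fin n → ℝ) × Ω)) [IsFiniteMeasure m] (s : Set _),
      1 / 3 ≤ m.real s → (1 : ENNReal) / 3 ≤ m s := by
    intro m _ s h
    rw [← ENNReal.ofReal_toReal (measure_ne_top m s)]
    refine le_trans (le_of_eq ?_) (ENNReal.ofReal_le_ofReal h)
    rw [ENNReal.ofReal_div_of_pos (by norm_num)]
    simp
  rcases le_or_gt (1 / 3) (((Measure.pi fun _ : Fin n => twoStep A g t w).prod ν).real
    {p | t ≤ alg p}) with h | h
  · refine ⟨twoStep A g t w, 0, w, _, hP, le_rfl, ht0.trans htw, hw1,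
      twoStep_eq_withDensity hA0.le hg0.le, hfge _ _ hgA le_rfl, hf0 _ _,
      (third ((Measure.pi fun _ : Fin n => twoStep A g t w).prod ν) _ h).trans
        (measure_mono fun p hp => ?_)⟩
    exact (hbound A hA0 hA2).trans
      (regret_twoStep_of_ge hA0 hg0.le htw.le hq0 hδ hAt hp)
  · refine ⟨twoStep g B t w, 0, w, _, hQ, le_rfl, ht0.trans htw, hw1,
      twoStep_eq_withDensity hg0.le hB0.le, hfge _ _ le_rfl hgB, hf0 _ _,
      (third ((Measure.pi fun _ : Fin n => twoStep g B t w).prod ν) {p | t ≤ alg p}ᶜ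
        (by linarith)).trans (measure_mono fun p hp => ?_)⟩
    exact (hbound B hB0 hB2).trans
      (regret_twoStep_of_le hg0.le hB0 ht0.le hδ hgt (by linarith)
        (lt_of_not_ge (mem_compl_iff _ _ |>.1 hp)).le)
end
end
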